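/- Let w be an even positive integer and H_w the graph on {(i,j) : i,j ∈ [w]} with cliques Q_i = {(i,j) : j ∈ [w]} and cross edges {(i,j),(j,i)} for i ≠ j. Every hitting set of the bramble B_w = { H_w[B(i,Z)] : i ∈ [w], Z ⊆ [w]∖{i}, |Z| = w/2 }, where B(i,Z) = {(i,j),(j,i) : j ∈ Z}, has size at least w²/16. -/

import Mathlib

open scoped Classical

noncomputable section

/-- A multigraph on vertex type `V`: a set of vertices together with a multiset of
(undirected, loopless) edges, parallel edges being allowed. -/
structure MGraph (V : Type) where
  verts : Set V
  edges : Multiset (Sym2 V)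

namespace MGraph

variable {V : Type}

/-- The degree of a vertex: the number of incident edges, with multiplicity. -/
def degree (G : MGraph V) (x : V) : ℕ :=
  (G.edges.filter (fun e => x ∈ e)).card

/-- The set of neighbours of a vertex. -/
def nbrSet (G : MGraph V) (x : V) : Set V :=
  {y | y ≠ x ∧ s(x, y) ∈ G.edges}

/-- `δ_G(A,B)`: the multiset of edges of `G` with one endpoint in `A` and the other in `B`. -/
def cut (G : MGraph V) (A B : Set V) : Multiset (Sym2 V) :=
  G.edges.filter (fun e => ∃ a ∈ A, ∃ b ∈ B, e = s(a, b))

/-- Adjacency in a multigraph. -/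
def Adj (G : MGraph V) (x y : V) : Prop := x ≠ y ∧ s(x, y) ∈ G.edges

/-- Connectivity of a multigraph. -/
def Connected (G : MGraph V) : Prop :=
  G.verts.Nonempty ∧ ∀ x ∈ G.verts, ∀ y ∈ G.verts, Relation.ReflTransGen G.Adj x y

/-- Deleting a (multi)set of edges from a multigraph. -/
def deleteEdges (G : MGraph V) (F : Multiset (Sym2 V)) : MGraph V :=
  ⟨G.verts, G.edges - F⟩

/-- A multigraph is 3-edge-connected if it is connected and remains connected after
removal of any set of at most 2 edges. -/
def ThreeEdgeConnected (G : MGraph V) : Prop :=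
  G.Connected ∧ ∀ F : Multiset (Sym2 V), F ≤ G.edges → Multiset.card F ≤ 2 →
    (G.deleteEdges F).Connected

/-- The induced sub-multigraph on a set of vertices. -/
def induce (G : MGraph V) (S : Set V) : MGraph V :=
  ⟨G.verts ∩ S, G.edges.filter (fun e => ∀ v ∈ e, v ∈ S)⟩

/-- `∂_G(S)`: the vertices of `S` having a neighbour outside of `S`. -/
def boundary (G : MGraph V) (S : Set V) : Set V :=
  {x | x ∈ S ∧ ∃ u, u ∈ G.verts ∧ u ∉ S ∧ s(x, u) ∈ G.edges}

/-- `|δ_G({x}, V(G)∖S)|`: the number of edges from `x` to the outside of `S`. -/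
def bWeight (G : MGraph V) (S : Set V) (x : V) : ℕ :=
  (G.edges.filter (fun e => ∃ u, u ∈ G.verts ∧ u ∉ S ∧ e = s(x, u))).card

/-- Dissolving step used in the definition of the 3-center of `(G, X)`: a vertex `x ∉ X`
of degree 2 with exactly two (distinct) neighbours `y, z` is removed and the edge `yz`
is added (increasing its multiplicity if it is already present). -/
def DissolveStep (X : Set V) (G G' : MGraph V) : Prop :=
  ∃ x y z, x ∉ X ∧ x ∈ G.verts ∧ y ≠ z ∧ x ≠ y ∧ x ≠ z ∧
    G.edges.filter (fun e => x ∈ e) = {s(x, y), s(x, z)} ∧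
    G' = ⟨G.verts \ {x}, G.edges.filter (fun e => x ∉ e) + {s(y, z)}⟩

/-- Deletion step used in the definition of the 3-center of `(G, X)`: a vertex `x ∉ X`
of degree at most 2 with at most one neighbour is removed. -/
def DeleteStep (X : Set V) (G G' : MGraph V) : Prop :=
  ∃ x, x ∉ X ∧ x ∈ G.verts ∧ G.degree x ≤ 2 ∧ (G.nbrSet x).Subsingleton ∧
    G' = ⟨G.verts \ {x}, G.edges.filter (fun e => x ∉ e)⟩

def CenterStep (X : Set V) (G G' : MGraph V) : Prop :=
  DissolveStep X G G' ∨ DeleteStep X G G'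

/-- `H` is a 3-center of `(G, X)` if it is obtained from `G` by repeatedly applying
dissolve/delete steps until none applies. -/
def IsThreeCenter (X : Set V) (G H : MGraph V) : Prop :=
  Relation.ReflTransGen (CenterStep X) G H ∧ ∀ H', ¬ CenterStep X H H'

/-- `(T, X)` is a tree-cut decomposition of `G`: `T` is a tree and the bags `X t` are
pairwise disjoint with union `V(G)`. -/
def IsTCD {ι : Type} (G : MGraph V) (T : SimpleGraph ι) (X : ι → Set V) : Prop :=
  T.IsTree ∧ (Pairwise fun t t' => Disjoint (X t) (X t')) ∧ (⋃ t, X t) = G.verts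

/-- Given a tree edge `{a,b}` of `T`, the union of the bags over the component of
`T - {a,b}` containing `a`. -/
def edgeSide {ι : Type} (T : SimpleGraph ι) (X : ι → Set V) (a b : ι) : Set V :=
  ⋃ t ∈ {t | (T.deleteEdges {s(a, b)}).Reachable a t}, X t

/-- The adhesion `δ^T({a,b})` of a tree edge of a tree-cut decomposition. -/
def adhesion (G : MGraph V) {ι : Type} (T : SimpleGraph ι) (X : ι → Set V) (a b : ι) :
    Multiset (Sym2 V) :=
  G.cut (edgeSide T X a b) (edgeSide T X b a)

/-- `a` and `b` are connected in `T - t`. -/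
def ReachAvoid {ι : Type} (T : SimpleGraph ι) (t a b : ι) : Prop :=
  ∃ (ha : a ∈ ({t}ᶜ : Set ι)) (hb : b ∈ ({t}ᶜ : Set ι)),
    (T.induce ({t}ᶜ : Set ι)).Reachable ⟨a, ha⟩ ⟨b, hb⟩

/-- The neighbour of `t` indexing the component of `T - t` whose bags contain `v`. -/
def compOf {ι : Type} (T : SimpleGraph ι) (X : ι → Set V) (t : ι) (v : V) : ι :=
  if h : ∃ s, T.Adj t s ∧ ∃ t', v ∈ X t' ∧ ReachAvoid T t s t' then h.choose else t

/-- The identification map used in the definition of the torso at `t`. -/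
def torsoMap {ι : Type} (T : SimpleGraph ι) (X : ι → Set V) (t : ι) (v : V) : V ⊕ ι :=
  if v ∈ X t then Sum.inl v else Sum.inr (compOf T X t v)

/-- The torso of `G` at node `t` of the tree-cut decomposition `(T, X)`: each non-empty
union of bags over a component of `T - t` is identified to a single vertex (components
are indexed by the corresponding neighbour of `t`); parallel edges are kept, loops
are discarded. -/
def torso {ι : Type} (G : MGraph V) (T : SimpleGraph ι) (X : ι → Set V) (t : ι) :
    MGraph (V ⊕ ι) :=
  ⟨Sum.inl '' (X t) ∪
     Sum.inr '' {s | T.Adj t s ∧ ∃ t' v, v ∈ X t' ∧ ReachAvoid T t s t'},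
   (G.edges.map (Sym2.map (torsoMap T X t))).filter (fun e => ¬ e.IsDiag)⟩

/-- The width of the tree-cut decomposition `(T, X)` of `G` is at most `w`: all
adhesions have at most `w` edges and all 3-centers of torsos have at most `w` vertices. -/
def WidthLE {ι : Type} (G : MGraph V) (T : SimpleGraph ι) (X : ι → Set V) (w : ℕ) : Prop :=
  (∀ a b, T.Adj a b → Multiset.card (adhesion G T X a b) ≤ w) ∧
  ∀ t H, IsThreeCenter (Sum.inl '' (X t)) (torso G T X t) H → H.verts.ncard ≤ w

/-- `G` has a tree-cut decomposition of width at most `w`. -/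
def tcwLE (G : MGraph V) (w : ℕ) : Prop :=
  ∃ (ι : Type) (_ : Finite ι) (T : SimpleGraph ι) (X : ι → Set V),
    IsTCD G T X ∧ WidthLE G T X w

/-- The tree-cut width of a multigraph. -/
def tcw (G : MGraph V) : ℕ := sInf {w | tcwLE G w}

/-- A leaf of a tree: a node with exactly one neighbour. -/
def IsLeaf {ι : Type} (T : SimpleGraph ι) (t : ι) : Prop := ∃! s, T.Adj t s

/-- The internal width of `(T, X)` is at most `w`: all adhesions are at most `w` and the
3-center torso sizes of all *non-leaf* nodes are at most `w`. -/
def InWidthLE {ι : Type} (G : MGraph V) (T : SimpleGraph ι) (X : ι → Set V) (w : ℕ) : Prop :=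
  (∀ a b, T.Adj a b → Multiset.card (adhesion G T X a b) ≤ w) ∧
  ∀ t, ¬ IsLeaf T t →
    ∀ H, IsThreeCenter (Sum.inl '' (X t)) (torso G T X t) H → H.verts.ncard ≤ w

/-- A tree-cut decomposition is non-trivial if at least two bags are non-empty. -/
def NonTrivial {ι : Type} (X : ι → Set V) : Prop :=
  ∃ t t', t ≠ t' ∧ (X t).Nonempty ∧ (X t').Nonempty

/-- Identifying the vertex set `S` of `G` into the single vertex `v₀ ∈ S`:
edges inside `S` are deleted (loops discarded), parallel edges are kept. -/
def collapse (G : MGraph V) (S : Set V) (v₀ : V) : MGraph V :=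
  ⟨(G.verts \ S) ∪ {v₀},
   (G.edges.map (Sym2.map (fun x => if x ∈ S then v₀ else x))).filter (fun e => ¬ e.IsDiag)⟩

/-- One step of taking an immersion: deleting an edge, deleting a vertex, or lifting a
pair of edges `{x,v}, {v,y}` to the single edge `{x,y}`. -/
def ImmStep (G G' : MGraph V) : Prop :=
  (∃ e ∈ G.edges, G' = ⟨G.verts, G.edges.erase e⟩) ∨
  (∃ v ∈ G.verts, G' = ⟨G.verts \ {v}, G.edges.filter (fun e => v ∉ e)⟩) ∨
  (∃ x v y, x ≠ v ∧ y ≠ v ∧ x ≠ y ∧ s(x, v) ∈ G.edges ∧ s(v, y) ∈ G.edges.erase s(x, v) ∧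
    G' = ⟨G.verts, s(x, y) ::ₘ ((G.edges.erase s(x, v)).erase s(v, y))⟩)

/-- `H` is an immersion of `G`. -/
def IsImmersion (H G : MGraph V) : Prop := Relation.ReflTransGen ImmStep G H

end MGraph

/-- The multigraph associated to a simple graph. -/
def SimpleGraph.toMGraph {α : Type} [Fintype α] (G : SimpleGraph α) : MGraph α :=
  ⟨Set.univ, (Set.toFinite G.edgeSet).toFinset.val⟩

/-- The star with `ℓ` leaves: center `none`, leaves `some i`. -/
def starGraph (ℓ : ℕ) : SimpleGraph (Option (Fin ℓ)) :=
  SimpleGraph.fromRel (fun a _ => a = none)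

/-- The graph `H_w`: `w` disjoint cliques `Q_i = {(i,j) : j}` of size `w`, together with
the cross edges `{(i,j),(j,i)}` for `i ≠ j`. -/
def Hw (w : ℕ) : SimpleGraph (Fin w × Fin w) :=
  SimpleGraph.fromRel (fun p q => p.1 = q.1 ∨ (q.1 = p.2 ∧ q.2 = p.1))

/-- Two vertex sets touch in `G`: they intersect or are joined by an edge. -/
def Touch {α : Type} (G : SimpleGraph α) (A B : Set α) : Prop :=
  (A ∩ B).Nonempty ∨ ∃ a ∈ A, ∃ b ∈ B, G.Adj a b

/-- A bramble: a collection of (vertex sets of) connected subgraphs pairwise touching. -/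
def IsBramble {α : Type} (G : SimpleGraph α) (ℬ : Set (Set α)) : Prop :=
  (∀ A ∈ ℬ, (G.induce A).Connected) ∧ ∀ A ∈ ℬ, ∀ B ∈ ℬ, Touch G A B

/-- `B(i,Z) = {(i,j) : j ∈ Z} ∪ {(j,i) : j ∈ Z}`. -/
def Bset (w : ℕ) (i : Fin w) (Z : Finset (Fin w)) : Set (Fin w × Fin w) :=
  {p | (p.1 = i ∧ p.2 ∈ Z) ∨ (p.2 = i ∧ p.1 ∈ Z)}

/-- The bramble `B_w = {H_w[B(i,Z)] : i ∈ [w], Z ⊆ [w]∖{i}, |Z| = w/2}`. -/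
def Bfam (w : ℕ) : Set (Set (Fin w × Fin w)) :=
  {A | ∃ (i : Fin w) (Z : Finset (Fin w)), i ∉ Z ∧ Z.card = w / 2 ∧ A = Bset w i Z}

/-- `(T, Y)` is a tree decomposition of the simple graph `G`. -/
def IsTreeDecomp {α ι : Type} (G : SimpleGraph α) (T : SimpleGraph ι) (Y : ι → Set α) : Prop :=
  T.IsTree ∧ (∀ v, ∃ x, v ∈ Y x) ∧
  (∀ u v, G.Adj u v → ∃ x, u ∈ Y x ∧ v ∈ Y x) ∧
  (∀ v, (T.induce {x | v ∈ Y x}).Connected)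

/-- `G` has treewidth at most `k`. -/
def twLE {α : Type} (G : SimpleGraph α) (k : ℕ) : Prop :=
  ∃ (ι : Type) (_ : Finite ι) (T : SimpleGraph ι) (Y : ι → Set α),
    IsTreeDecomp G T Y ∧ ∀ x, (Y x).ncard ≤ k + 1

end
noncomputable section
open scoped Classical

namespace MGraph

variable {V : Type}

/-- The weight function `γ'` of Lemma 4: `γ'(v) = |δ_G({v}, V(G)∖S)|` for `v ∈ S`,
and `0` otherwise. -/
def gammaExt (G : MGraph V) (S : Set V) (v : V) : ℕ :=
  if v ∈ S then G.bWeight S v else 0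

/-- `γ'(T_b)` where `T_b` is the component of `T - {a,b}` containing `b`. -/
def sideWeight (G : MGraph V) {ι : Type} (T : SimpleGraph ι) (X : ι → Set V)
    (S : Set V) (a b : ι) : ℕ :=
  ∑ᶠ t ∈ {t | (T.deleteEdges {s(a, b)}).Reachable b t}, ∑ᶠ v ∈ X t, G.gammaExt S v

/-- The edge `{x,y}` of `T` is oriented from `x` to `y` by Rule 1 (`γ'(T_y) > w`) or by
Rule 2 (`S` avoids all the bags on the `x`-side). -/
def ruleOrient (G : MGraph V) {ι : Type} (T : SimpleGraph ι) (X : ι → Set V)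
    (S : Set V) (w : ℕ) (x y : ι) : Prop :=
  w < G.sideWeight T X S x y ∨ S ∩ edgeSide T X x y = ∅

end MGraph

/-- The tree obtained from `T` by attaching `ℓ` new leaves to the node `t`
(`t` plays the role of the center of the star replacing the former leaf `t`). -/
def refineTree {ι : Type} (T : SimpleGraph ι) (t : ι) (ℓ : ℕ) : SimpleGraph (ι ⊕ Fin ℓ) :=
  SimpleGraph.fromRel (fun a b =>
    (∃ i j, a = Sum.inl i ∧ b = Sum.inl j ∧ T.Adj i j) ∨
    (a = Sum.inl t ∧ ∃ i, b = Sum.inr i))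

/-- The bags of the refined decomposition: the bag of the former leaf `t` is replaced by
the central bag `Xs none` of the star decomposition, the new leaves get the leaf bags. -/
def refineBags {V ι : Type} (X : ι → Set V) (t : ι) {ℓ : ℕ}
    (Xs : Option (Fin ℓ) → Set V) : ι ⊕ Fin ℓ → Set V :=
  fun s => Sum.rec (fun a => if a = t then Xs none else X a) (fun i => Xs (some i)) s

/-- `w = n³/2 + k`, the target width in the Min Bisection reduction. -/
def bisectW (n k : ℕ) : ℕ := n ^ 3 / 2 + k

/-- The vertex type of the graph `G'` of the Min Bisection reduction:
`V = Fin n`, `Q = Fin (w-2)`, and a set `C_{x,y}` of `w+1` vertices for each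
(unordered) pair `x < y` of vertices of `Q`. -/
abbrev BisV (n w : ℕ) : Type :=
  Fin n ⊕ (Fin (w - 2) ⊕ (({p : Fin (w - 2) × Fin (w - 2) // p.1 < p.2}) × Fin (w + 1)))

/-- The (one-directional) edge relation of `G'`: `V` induces a copy of `G`; each vertex
`a ∈ V` is adjacent to the `n²` vertices `f a ⊆ Q`; every vertex of `C_{x,y}` is
adjacent to both `x` and `y`. -/
def bisectR {n : ℕ} (G : SimpleGraph (Fin n)) (w : ℕ) (f : Fin n → Finset (Fin (w - 2))) :
    BisV n w → BisV n w → Prop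
  | Sum.inl a, Sum.inl b => G.Adj a b
  | Sum.inl a, Sum.inr (Sum.inl q) => q ∈ f a
  | Sum.inr (Sum.inl q), Sum.inr (Sum.inr c) => q = c.1.1.1 ∨ q = c.1.1.2
  | _, _ => False

/-- The graph `G'` of the Min Bisection reduction. -/
def bisectG {n : ℕ} (G : SimpleGraph (Fin n)) (w : ℕ) (f : Fin n → Finset (Fin (w - 2))) :
    SimpleGraph (BisV n w) :=
  SimpleGraph.fromRel (bisectR G w f)

/-- The multiset of edges used by a walk, given as its list of vertices. -/
def walkEdges {V : Type} (l : List V) : Multiset (Sym2 V) :=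
  ↑((l.zip l.tail).map fun p => s(p.1, p.2))

end

noncomputable section
open scoped Classical
open MGraph

theorem Bfam_hittingSet_lower_bound (w : ℕ) (hw : 0 < w) (hweven : Even w)
    (S : Set (Fin w × Fin w)) (hS : ∀ A ∈ Bfam w, (A ∩ S).Nonempty) :
    (w : ℝ) ^ 2 / 16 ≤ S.ncard := by
  obtain ⟨k, hk⟩ := hweven
  set T : Finset (Fin w × Fin w) := S.toFinite.toFinset with hT
  have hmem : ∀ p, p ∈ T ↔ p ∈ S := fun p => by simp [hT]
  have hcard : S.ncard = T.card := Set.ncard_eq_toFinset_card S S.toFinite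
  have key : ∀ i : Fin w,
      k ≤ (T.filter (fun p => p.1 = i)).card + (T.filter (fun p => p.2 = i)).card := by
    intro i
    set N : Finset (Fin w) := (T.filter (fun p => p.1 = i)).image Prod.snd ∪
      (T.filter (fun p => p.2 = i)).image Prod.fst with hN
    have hNc : N.card ≤ (T.filter (fun p => p.1 = i)).card +
        (T.filter (fun p => p.2 = i)).card :=
      (Finset.card_union_le _ _).trans (add_le_add Finset.card_image_le Finset.card_image_le)
    refine le_trans ?_ hNc
    by_contra hlt
    have h1 : (insert i N).card ≤ N.card + 1 := Finset.card_insert_le _ _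
    have h2 : (insert i N)ᶜ.card = w - (insert i N).card := by
      rw [Finset.card_compl, Fintype.card_fin]
    have h3 : k ≤ (insert i N)ᶜ.card := by omega
    obtain ⟨Z, hZ, hZc⟩ := Finset.exists_subset_card_eq h3
    have hiZ : i ∉ Z := fun h => by
      have := hZ h
      simp at this
    have hZN : ∀ j ∈ Z, j ∉ N := fun j h hjN => by
      have := hZ h
      simp only [Finset.mem_compl, Finset.mem_insert, not_or] at this
      exact this.2 hjN
    obtain ⟨p, hp, hpS⟩ := hS (Bset w i Z) ⟨i, Z, hiZ, by omega, rfl⟩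
    rcases hp with ⟨ha, hb⟩ | ⟨ha, hb⟩
    · refine hZN _ hb (Finset.mem_union_left _ (Finset.mem_image_of_mem _ ?_))
      exact Finset.mem_filter.2 ⟨(hmem p).2 hpS, ha⟩
    · refine hZN _ hb (Finset.mem_union_right _ (Finset.mem_image_of_mem _ ?_))
      exact Finset.mem_filter.2 ⟨(hmem p).2 hpS, ha⟩
  have e1 : T.card = ∑ i : Fin w, (T.filter (fun p => p.1 = i)).card :=
    Finset.card_eq_sum_card_fiberwise (fun _ _ => Finset.mem_coe.2 (Finset.mem_univ _))
  have e2 : T.card = ∑ i : Fin w, (T.filter (fun p => p.2 = i)).card :=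
    Finset.card_eq_sum_card_fiberwise (fun _ _ => Finset.mem_coe.2 (Finset.mem_univ _))
  have hsum : w * k ≤ T.card + T.card := by
    calc w * k = ∑ _i : Fin w, k := by simp
      _ ≤ _ := Finset.sum_le_sum (fun i _ => key i)
      _ = T.card + T.card := by rw [Finset.sum_add_distrib, ← e1, ← e2]
  rw [hcard]
  have hsumR : (w : ℝ) * k ≤ T.card + T.card := by exact_mod_cast hsum
  have hkR : (w : ℝ) = k + k := by exact_mod_cast hk
  rw [hkR] at hsumR ⊢
  nlinarith [sq_nonneg (k : ℝ)]

end
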